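/- Let α be an ℓ×ℓ matrix over F such that α i j = 0 whenever d i − d j ≠ −2. For x, y ∈ N_{≥1}(d) define ⟨x, y⟩ = trace(α·((x−1)·(y−1) − (y−1)·(x−1))). Then: (a) ⟨x·x', y⟩ = ⟨x, y⟩ + ⟨x', y⟩ and ⟨x, y·y'⟩ = ⟨x, y⟩ + ⟨x, y'⟩ for all x, x', y, y' ∈ N_{≥1}(d); (b) ⟨x, x⟩ = 0 for all x ∈ N_{≥1}(d); (c) ⟨x, y⟩ = 0 whenever x ∈ N_{≥2}(d) or y ∈ N_{≥2}(d). Consequently ⟨·,·⟩ induces a well-defined alternating biadditive pairing on the quotient group N_{≥1}(d)/N_{≥2}(d). -/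

import Mathlib

/-- The unipotent subgroup `N_{≥w}(d)`. -/
def Nge (F : Type*) [Field F] {ℓ : ℕ} (d : Fin ℓ → ℤ) (w : ℤ) :
    Set (Matrix (Fin ℓ) (Fin ℓ) F) :=
  {x | (∀ i, x i i = 1) ∧ ∀ i j, i ≠ j → d i - d j < w → x i j = 0}

/-- The pairing `⟨x, y⟩ = tr(α · [x - 1, y - 1])` of equation (1.13). -/
def pairingMap {F : Type*} [Field F] {ℓ : ℕ} (α x y : Matrix (Fin ℓ) (Fin ℓ) F) : F :=
  Matrix.trace (α * ((x - 1) * (y - 1) - (y - 1) * (x - 1)))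

/-- The matrices whose entries in weight less than `w` vanish. -/
def WeightGE {F : Type*} [Field F] {ℓ : ℕ} (d : Fin ℓ → ℤ) (w : ℤ)
    (A : Matrix (Fin ℓ) (Fin ℓ) F) : Prop :=
  ∀ i j, d i - d j < w → A i j = 0

section

variable {F : Type*} [Field F] {ℓ : ℕ} {d : Fin ℓ → ℤ} {v w : ℤ}
  {α A B x x' y : Matrix (Fin ℓ) (Fin ℓ) F}

theorem WeightGE.mul (hA : WeightGE d v A) (hB : WeightGE d w B) :
    WeightGE d (v + w) (A * B) := by
  intro i j hij
  rw [Matrix.mul_apply]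
  refine Finset.sum_eq_zero fun k _ => ?_
  by_cases hik : d i - d k < v
  · rw [hA i k hik, zero_mul]
  · rw [hB k j (by lia), mul_zero]

theorem WeightGE.sub (hA : WeightGE d w A) (hB : WeightGE d w B) : WeightGE d w (A - B) := by
  intro i j hij
  rw [Matrix.sub_apply, hA i j hij, hB i j hij, sub_zero]

theorem WeightGE.commutator (hA : WeightGE d v A) (hB : WeightGE d w B) :
    WeightGE d (v + w) (A * B - B * A) :=
  (hA.mul hB).sub (add_comm w v ▸ hB.mul hA)

theorem WeightGE.trace_mul_eq_zero (hα : ∀ i j, d i - d j ≠ -2 → α i j = 0)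
    (hA : WeightGE d 3 A) : Matrix.trace (α * A) = 0 := by
  refine Finset.sum_eq_zero fun i _ => ?_
  rw [Matrix.diag_apply, Matrix.mul_apply]
  refine Finset.sum_eq_zero fun j _ => ?_
  by_cases hij : d i - d j = -2
  · rw [hA j i (by lia), mul_zero]
  · rw [hα i j hij, zero_mul]

theorem weightGE_sub_one_of_mem_Nge (hx : x ∈ Nge F d w) : WeightGE d w (x - 1) := by
  intro i j hij
  by_cases h : i = j
  · subst h
    simp [hx.1 i]
  · simp [hx.2 i j h hij, h]

theorem Nge_anti (h : v ≤ w) : Nge F d w ⊆ Nge F d v :=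
  fun _ hx => ⟨hx.1, fun i j hij hlt => hx.2 i j hij (hlt.trans_le h)⟩

theorem pairingMap_swap (α x y : Matrix (Fin ℓ) (Fin ℓ) F) :
    pairingMap α x y = -pairingMap α y x := by
  rw [pairingMap, pairingMap, ← Matrix.trace_neg, ← mul_neg, neg_sub]

theorem pairingMap_mul_left (hα : ∀ i j, d i - d j ≠ -2 → α i j = 0)
    (hx : x ∈ Nge F d 1) (hx' : x' ∈ Nge F d 1) (hy : y ∈ Nge F d 1) :
    pairingMap α (x * x') y = pairingMap α x y + pairingMap α x' y := by
  have h := (((weightGE_sub_one_of_mem_Nge hx).mul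
    (weightGE_sub_one_of_mem_Nge hx')).commutator
      (weightGE_sub_one_of_mem_Nge hy)).trace_mul_eq_zero hα
  rw [pairingMap, pairingMap, pairingMap, ← Matrix.trace_add, ← add_zero (Matrix.trace (_ + _)),
    ← h, ← Matrix.trace_add]
  congr 1
  noncomm_ring

theorem pairingMap_mul_right (hα : ∀ i j, d i - d j ≠ -2 → α i j = 0) {y' : Matrix _ _ F}
    (hx : x ∈ Nge F d 1) (hy : y ∈ Nge F d 1) (hy' : y' ∈ Nge F d 1) :
    pairingMap α x (y * y') = pairingMap α x y + pairingMap α x y' := by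
  rw [pairingMap_swap, pairingMap_mul_left hα hy hy' hx, pairingMap_swap α x y,
    pairingMap_swap α x y', neg_add]

theorem pairingMap_eq_zero_left (hα : ∀ i j, d i - d j ≠ -2 → α i j = 0)
    (hx : x ∈ Nge F d 2) (hy : y ∈ Nge F d 1) : pairingMap α x y = 0 :=
  ((weightGE_sub_one_of_mem_Nge hx).commutator
    (weightGE_sub_one_of_mem_Nge hy)).trace_mul_eq_zero hα

theorem pairingMap_eq_zero_right (hα : ∀ i j, d i - d j ≠ -2 → α i j = 0)
    (hx : x ∈ Nge F d 1) (hy : y ∈ Nge F d 2) : pairingMap α x y = 0 := by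
  rw [pairingMap_swap, pairingMap_eq_zero_left hα hy hx, neg_zero]

theorem isUnit_det_of_inv_mul_mem_Nge (hℓ : 0 < ℓ) (h : x⁻¹ * x' ∈ Nge F d w) :
    IsUnit x.det := by
  by_contra hdet
  have h₁ := h.1 ⟨0, hℓ⟩
  rw [Matrix.nonsing_inv_apply_not_isUnit _ hdet, zero_mul] at h₁
  exact zero_ne_one h₁

theorem pairingMap_congr_left (hℓ : 0 < ℓ) (hα : ∀ i j, d i - d j ≠ -2 → α i j = 0)
    (hx : x ∈ Nge F d 1) (hy : y ∈ Nge F d 1) (h : x⁻¹ * x' ∈ Nge F d 2) :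
    pairingMap α x y = pairingMap α x' y := by
  rw [← Matrix.mul_nonsing_inv_cancel_left x x' (isUnit_det_of_inv_mul_mem_Nge hℓ h),
    pairingMap_mul_left hα hx (Nge_anti one_le_two h) hy, pairingMap_eq_zero_left hα h hy,
    add_zero]

end

theorem pairing_symplectic (F : Type*) [Field F] (ℓ : ℕ) (hℓ : 0 < ℓ) (d : Fin ℓ → ℤ)
    (α : Matrix (Fin ℓ) (Fin ℓ) F)
    (hα : ∀ i j, d i - d j ≠ -2 → α i j = 0) :
    -- (a): biadditivity
    (∀ x ∈ Nge F d 1, ∀ x' ∈ Nge F d 1, ∀ y ∈ Nge F d 1,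
      pairingMap α (x * x') y = pairingMap α x y + pairingMap α x' y) ∧
    (∀ x ∈ Nge F d 1, ∀ y ∈ Nge F d 1, ∀ y' ∈ Nge F d 1,
      pairingMap α x (y * y') = pairingMap α x y + pairingMap α x y') ∧
    -- (b): alternating
    (∀ x ∈ Nge F d 1, pairingMap α x x = 0) ∧
    -- (c): vanishing when one argument is in N_{≥2}(d)
    (∀ x ∈ Nge F d 2, ∀ y ∈ Nge F d 1, pairingMap α x y = 0) ∧
    (∀ x ∈ Nge F d 1, ∀ y ∈ Nge F d 2, pairingMap α x y = 0) ∧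
    -- consequently, the pairing is well defined on the quotient N_{≥1}(d)/N_{≥2}(d)
    (∀ x ∈ Nge F d 1, ∀ x' ∈ Nge F d 1, ∀ y ∈ Nge F d 1, ∀ y' ∈ Nge F d 1,
      x⁻¹ * x' ∈ Nge F d 2 → y⁻¹ * y' ∈ Nge F d 2 →
      pairingMap α x y = pairingMap α x' y') := by
  refine ⟨fun x hx x' hx' y hy => pairingMap_mul_left hα hx hx' hy,
    fun x hx y hy y' hy' => pairingMap_mul_right hα hx hy hy', fun x _ => by simp [pairingMap],
    fun x hx y hy => pairingMap_eq_zero_left hα hx hy,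
    fun x hx y hy => pairingMap_eq_zero_right hα hx hy,
    fun x hx x' hx' y hy y' hy' hxx' hyy' => ?_⟩
  rw [pairingMap_congr_left hℓ hα hx hy hxx', pairingMap_swap,
    pairingMap_congr_left hℓ hα hy hx' hyy', ← pairingMap_swap]
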